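/- Every d-dimensional convex polytope K ⊆ ℝ^d with n vertices satisfies L_K ≤ C √(n/d) for a universal constant C > 0. -/

import Mathlib

open scoped RealInnerProductSpace
open MeasureTheory
noncomputable section

/-- The set of normalized inertia integrals over all volume-preserving affine images of `K`:
`d ⬝ L_K² = sInf (isoSet d K)`. -/
def isoSet (d : ℕ) (K : Set (EuclideanSpace ℝ (Fin d))) : Set ℝ :=
  {r | ∃ (a : EuclideanSpace ℝ (Fin d))
      (T : EuclideanSpace ℝ (Fin d) →ₗ[ℝ] EuclideanSpace ℝ (Fin d)),
    LinearMap.det T = 1 ∧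
    r = ((volume K).toReal) ^ (-(1 + 2 / (d : ℝ))) * ∫ x in (fun y => a + T y) '' K, ‖x‖ ^ 2}

/-- The isotropy constant of a convex body `K ⊆ ℝ^d`. -/
def isoConst (d : ℕ) (K : Set (EuclideanSpace ℝ (Fin d))) : ℝ :=
  Real.sqrt (sInf (isoSet d K) / d)

/-- The first nonzero entry of `c` exists and is positive. -/
def LexPos {n : ℕ} (c : Fin n → ℝ) : Prop :=
  ∃ k, (∀ j < k, c j = 0) ∧ 0 < c k

lemma LexPos.not_neg {n : ℕ} {c : Fin n → ℝ} (h : LexPos c) : ¬ LexPos (-c) := by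
  rintro ⟨l, hl, hl'⟩
  obtain ⟨k, hk, hk'⟩ := h
  simp only [Pi.neg_apply, neg_eq_zero, Left.neg_pos_iff] at hl hl'
  rcases lt_trichotomy k l with h | h | h
  · exact hk'.ne' (hl k h)
  · subst h; exact hl'.not_gt hk'
  · exact hl'.ne (hk l h)

lemma LexPos.of_smul {n : ℕ} {c : Fin n → ℝ} {t : ℝ} (ht : 0 < t) (h : LexPos (t • c)) :
    LexPos c := by
  obtain ⟨k, hk, hk'⟩ := h
  refine ⟨k, fun j hj => ?_, ?_⟩
  · simpa [ht.ne'] using hk j hj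
  · simpa [ht] using hk'

lemma IsCompact.exists_lexPos_sub {n : ℕ} {A : Set (Fin n → ℝ)} (hA : IsCompact A)
    (hne : A.Nonempty) : ∃ a ∈ A, ∀ b ∈ A, b ≠ a → LexPos (b - a) := by
  have key : ∀ m ≤ n, ∃ B ⊆ A, IsCompact B ∧ B.Nonempty ∧
      (∀ a ∈ B, ∀ b ∈ B, ∀ j : Fin n, j.1 < m → b j = a j) ∧
      (∀ a ∈ B, ∀ b ∈ A, b ∉ B → LexPos (b - a)) := by
    intro m
    induction m with
    | zero => exact fun _ => ⟨A, subset_rfl, hA, hne, by simp, fun a _ b hb h => absurd hb h⟩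
    | succ m ih =>
      intro hm
      obtain ⟨B, hBA, hBc, hBn, hB1, hB2⟩ := ih (by omega)
      obtain ⟨z, hz, hzmin⟩ := hBc.exists_isMinOn hBn
        (continuous_apply (⟨m, hm⟩ : Fin n)).continuousOn
      refine ⟨B ∩ {a | a ⟨m, hm⟩ = z ⟨m, hm⟩}, Set.inter_subset_left.trans hBA,
        hBc.inter_right (isClosed_eq (continuous_apply _) continuous_const), ⟨z, hz, rfl⟩, ?_, ?_⟩
      · rintro a ⟨ha, ha'⟩ b ⟨hb, hb'⟩ j hj
        rcases Nat.lt_succ_iff_lt_or_eq.1 hj with h | h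
        · exact hB1 a ha b hb j h
        · obtain rfl : j = ⟨m, hm⟩ := Fin.ext h
          exact hb'.trans ha'.symm
      · rintro a ⟨ha, ha'⟩ b hbA hb
        by_cases hbB : b ∈ B
        · have hb' : b ⟨m, hm⟩ ≠ z ⟨m, hm⟩ := fun h => hb ⟨hbB, h⟩
          refine ⟨⟨m, hm⟩, fun j hj => ?_, ?_⟩
          · simpa [sub_eq_zero] using hB1 a ha b hbB j hj
          · have := lt_of_le_of_ne (hzmin hbB) hb'.symm
            have h2 : a ⟨m, hm⟩ = z ⟨m, hm⟩ := ha'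
            simpa [h2] using this
        · exact hB2 a ha b hbA hbB
  obtain ⟨B, hBA, -, ⟨a, ha⟩, h1, h2⟩ := key n le_rfl
  refine ⟨a, hBA ha, fun b hb hne => h2 a ha b hb fun hbB => hne ?_⟩
  ext j
  exact h1 a ha b hbB j j.2

section Weights

variable {E : Type*} [AddCommGroup E] [Module ℝ E]

/-- The barycentric weights that are lexicographically minimal among all the weights with the same
barycentre of `v`. -/
def lexMinWeights {n : ℕ} (v : Fin n → E) : Set (Fin n → ℝ) :=
  {a ∈ stdSimplex ℝ (Fin n) | ∀ b ∈ stdSimplex ℝ (Fin n),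
    Fintype.linearCombination ℝ v b = Fintype.linearCombination ℝ v a → b ≠ a → LexPos (b - a)}

lemma injOn_lexMinWeights {n : ℕ} (v : Fin n → E) :
    Set.InjOn (Fintype.linearCombination ℝ v) (lexMinWeights v) := by
  intro a ha b hb hab
  by_contra hne
  refine (ha.2 b hb.1 hab.symm (Ne.symm hne)).not_neg ?_
  simpa using hb.2 a ha.1 hab hne

lemma convexHull_range_eq_image_stdSimplex {n : ℕ} (v : Fin n → E) :
    convexHull ℝ (Set.range v) = Fintype.linearCombination ℝ v '' stdSimplex ℝ (Fin n) := by
  classical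
  rw [← convexHull_basis_eq_stdSimplex, LinearMap.image_convexHull, ← Set.range_comp]
  congr 2
  ext i
  simp [Fintype.linearCombination_apply]

lemma image_lexMinWeights [TopologicalSpace E] [IsTopologicalAddGroup E] [ContinuousSMul ℝ E]
    [T1Space E] {n : ℕ} (v : Fin n → E) :
    Fintype.linearCombination ℝ v '' lexMinWeights v = convexHull ℝ (Set.range v) := by
  rw [convexHull_range_eq_image_stdSimplex]
  refine (Set.image_mono fun a ha => ha.1).antisymm ?_
  rintro _ ⟨a, ha, rfl⟩
  have hcont : Continuous (Fintype.linearCombination ℝ v) := LinearMap.continuous_on_pi _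
  obtain ⟨b, hb, hmin⟩ := ((isCompact_stdSimplex ℝ (Fin n)).inter_right
    (isClosed_singleton.preimage hcont)).exists_lexPos_sub ⟨a, ha, rfl⟩
  refine ⟨b, ⟨hb.1, fun c hc hcb => hmin c ⟨hc, ?_⟩⟩, hb.2⟩
  exact hcb.trans hb.2

lemma exists_pos_forall_nonneg_add_smul {ι : Type*} [Finite ι] {a c : ι → ℝ}
    (ha : ∀ i, 0 ≤ a i) (hc : ∀ i, a i = 0 → 0 ≤ c i) :
    ∃ ε : ℝ, 0 < ε ∧ ∀ i, 0 ≤ (a + ε • c) i := by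
  have h : ∀ᶠ ε : ℝ in nhdsWithin 0 (Set.Ioi 0), ∀ i, 0 ≤ (a + ε • c) i := by
    refine Filter.eventually_all.2 fun i => ?_
    by_cases hi : a i = 0
    · filter_upwards [self_mem_nhdsWithin] with ε hε
      simpa [hi] using mul_nonneg (le_of_lt hε) (hc i hi)
    · have hcont : Continuous fun ε : ℝ => (a + ε • c) i := by
        simp only [Pi.add_apply, Pi.smul_apply]
        fun_prop
      have : ∀ᶠ ε : ℝ in nhds 0, 0 < (a + ε • c) i :=
        hcont.continuousAt.eventually_const_lt (by simpa using (ha i).lt_of_ne' hi)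
      exact (this.mono fun _ h => h.le).filter_mono nhdsWithin_le_nhds
  obtain ⟨ε, hε, hnn⟩ := (h.and (self_mem_nhdsWithin (s := Set.Ioi (0 : ℝ)))).exists
  exact ⟨ε, hnn, hε⟩

lemma mem_lexMinWeights_of_support {n : ℕ} {v : Fin n → E} {a b : Fin n → ℝ}
    (ha : a ∈ lexMinWeights v) (hb : b ∈ stdSimplex ℝ (Fin n)) (hab : ∀ i, a i = 0 → b i = 0) :
    b ∈ lexMinWeights v := by
  refine ⟨hb, fun c hc hcb hne => ?_⟩
  obtain ⟨ε, hε, hnn⟩ := exists_pos_forall_nonneg_add_smul ha.1.1 (c := c - b) fun i hi => by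
    simpa [hab i hi] using hc.1 i
  refine LexPos.of_smul hε ?_
  have hmem : a + ε • (c - b) ∈ stdSimplex ℝ (Fin n) := by
    refine ⟨hnn, ?_⟩
    simp [Finset.sum_add_distrib, ← Finset.mul_sum, ha.1.2, hb.2, hc.2]
  have := ha.2 _ hmem (by simp [hcb]) (by simpa [hε.ne', sub_eq_zero] using hne)
  simpa using this

lemma convex_lexMinWeights_support {n : ℕ} (v : Fin n → E) (S : Set (Fin n)) :
    Convex ℝ {a ∈ lexMinWeights v | Function.support a = S} := by
  rintro a ⟨ha, haS⟩ b ⟨hb, hbS⟩ s t hs ht hst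
  have hmem := convex_stdSimplex ℝ (Fin n) ha.1 hb.1 hs ht hst
  have hab : ∀ i, a i = 0 ↔ b i = 0 := fun i => by
    rw [← Function.notMem_support, ← Function.notMem_support, haS, hbS]
  refine ⟨mem_lexMinWeights_of_support ha hmem fun i hi => ?_, ?_⟩
  · simp [hi, (hab i).1 hi]
  · rw [← haS]
    ext i
    simp only [Function.mem_support, Pi.add_apply, Pi.smul_apply, smul_eq_mul, ne_eq, not_iff_not]
    refine ⟨fun h => ?_, fun h => by simp [h, (hab i).1 h]⟩
    by_contra hne
    have h1 := (ha.1.1 i).lt_of_ne' hne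
    have h2 := (hb.1.1 i).lt_of_ne' (mt (hab i).2 hne)
    nlinarith [mul_nonneg hs h1.le, mul_nonneg ht h2.le, min_le_left (a i) (b i),
      min_le_right (a i) (b i), lt_min h1 h2, mul_le_mul_of_nonneg_left (min_le_left (a i) (b i)) hs,
      mul_le_mul_of_nonneg_left (min_le_right (a i) (b i)) ht]

lemma card_support_le_of_mem_lexMinWeights [FiniteDimensional ℝ E] {n : ℕ} {v : Fin n → E}
    {a : Fin n → ℝ} (ha : a ∈ lexMinWeights v) :
    (Finset.univ.filter fun i => a i ≠ 0).card ≤ Module.finrank ℝ E + 1 := by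
  classical
  by_contra! hlt
  let f : (Fin n → ℝ) →ₗ[ℝ] E × ℝ × ({i // a i = 0} → ℝ) :=
    (Fintype.linearCombination ℝ v).prod
      ((Fintype.linearCombination ℝ fun _ => 1).prod (LinearMap.funLeft ℝ ℝ Subtype.val))
  have hcard := Finset.card_filter_add_card_filter_not (s := (Finset.univ : Finset (Fin n)))
    (fun i => a i = 0)
  have hker := f.ker_ne_bot_of_finrank_lt <| by
    simp only [Module.finrank_prod, Module.finrank_fintype_fun_eq_card, Fintype.card_fin,
      Module.finrank_self, Fintype.card_subtype] at hcard ⊢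
    simp only [Finset.card_univ, Fintype.card_fin] at hcard
    have h2 : (Finset.univ.filter fun i => ¬ a i = 0).card
      = (Finset.univ.filter fun i => a i ≠ 0).card := rfl
    omega
  obtain ⟨c, hc, hc0⟩ := (Submodule.ne_bot_iff _).1 hker
  have hcv : Fintype.linearCombination ℝ v c = 0 := congrArg Prod.fst hc
  have hcs : (Fintype.linearCombination ℝ fun _ : Fin n => (1 : ℝ)) c = 0 :=
    congrArg (fun p => p.2.1) hc
  have hcz : LinearMap.funLeft ℝ ℝ (Subtype.val : {i // a i = 0} → Fin n) c = 0 :=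
    congrArg (fun p => p.2.2) hc
  have hca : ∀ i, a i = 0 → c i = 0 := fun i hi => congrFun hcz ⟨i, hi⟩
  replace hcs : ∑ i, c i = 0 := by simpa [Fintype.linearCombination_apply] using hcs
  obtain ⟨ε, hε, hnn⟩ := exists_pos_forall_nonneg_add_smul ha.1.1 fun i hi => (hca i hi).ge
  have hmem : a + ε • c ∈ lexMinWeights v := by
    refine mem_lexMinWeights_of_support ha ⟨hnn, ?_⟩ fun i hi => by simp [hi, hca i hi]
    simp [Finset.sum_add_distrib, ← Finset.mul_sum, ha.1.2, hcs]
  have := injOn_lexMinWeights v hmem ha (by simp [hcv])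
  simp [hε.ne', hc0] at this

end Weights

section Moment

variable {E : Type*} [NormedAddCommGroup E] [NormedSpace ℝ E]

open Classical in
/-- The lexicographically minimal barycentric weights of a point of the convex hull of `v`,
extended by zero. -/
def lexWeight {n : ℕ} (v : Fin n → E) (x : E) : Fin n → ℝ :=
  if h : ∃ a ∈ lexMinWeights v, Fintype.linearCombination ℝ v a = x then h.choose else 0

lemma lexWeight_linearCombination {n : ℕ} {v : Fin n → E} {a : Fin n → ℝ}
    (ha : a ∈ lexMinWeights v) : lexWeight v (Fintype.linearCombination ℝ v a) = a := by
  have h : ∃ b ∈ lexMinWeights v,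
    Fintype.linearCombination ℝ v b = Fintype.linearCombination ℝ v a := ⟨a, ha, rfl⟩
  rw [lexWeight, dif_pos h]
  exact injOn_lexMinWeights v h.choose_spec.1 ha h.choose_spec.2

lemma lexWeight_of_notMem {n : ℕ} {v : Fin n → E} {x : E}
    (hx : x ∉ convexHull ℝ (Set.range v)) : lexWeight v x = 0 := by
  rw [← image_lexMinWeights] at hx
  exact dif_neg hx

lemma lexWeight_nonneg {n : ℕ} (v : Fin n → E) (x : E) (i : Fin n) : 0 ≤ lexWeight v x i := by
  by_cases hx : x ∈ convexHull ℝ (Set.range v)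
  · rw [← image_lexMinWeights] at hx
    obtain ⟨a, ha, rfl⟩ := hx
    rw [lexWeight_linearCombination ha]
    exact ha.1.1 i
  · simp [lexWeight_of_notMem hx]

lemma setOf_lt_lexWeight {n : ℕ} (v : Fin n → E) (i : Fin n) {s : ℝ} (hs : 0 ≤ s) :
    {x | s < lexWeight v x i} =
      Fintype.linearCombination ℝ v '' {a ∈ lexMinWeights v | s < a i} := by
  ext x
  constructor
  · intro hx
    have hxK : x ∈ convexHull ℝ (Set.range v) := by
      by_contra h
      rw [Set.mem_ofPred_eq, lexWeight_of_notMem h] at hx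
      exact hx.not_ge hs
    rw [← image_lexMinWeights] at hxK
    obtain ⟨a, ha, rfl⟩ := hxK
    rw [Set.mem_ofPred_eq, lexWeight_linearCombination ha] at hx
    exact ⟨a, ⟨ha, hx⟩, rfl⟩
  · rintro ⟨a, ⟨ha, has⟩, rfl⟩
    rwa [Set.mem_ofPred_eq, lexWeight_linearCombination ha]

variable [FiniteDimensional ℝ E] [MeasurableSpace E] [BorelSpace E] (μ : Measure E)
  [μ.IsAddHaarMeasure]

lemma nullMeasurableSet_lt_lexWeight {n : ℕ} (v : Fin n → E) (i : Fin n) (s : ℝ) :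
    NullMeasurableSet {x | s < lexWeight v x i} μ := by
  rcases lt_or_ge s 0 with hs | hs
  · have : {x | s < lexWeight v x i} = Set.univ :=
      Set.eq_univ_of_forall fun x => hs.trans_le (lexWeight_nonneg v x i)
    rw [this]
    exact MeasurableSet.univ.nullMeasurableSet
  have hU : {a ∈ lexMinWeights v | s < a i} =
      ⋃ S : Set (Fin n), {a ∈ lexMinWeights v | Function.support a = S} ∩ {a | s < a i} := by
    ext a
    simp [Set.mem_iUnion]
  rw [setOf_lt_lexWeight v i hs, hU, Set.image_iUnion]
  refine NullMeasurableSet.iUnion fun S => Convex.nullMeasurableSet μ ?_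
  exact ((convex_lexMinWeights_support v S).inter
    (convex_halfSpace_gt (LinearMap.proj i : (Fin n → ℝ) →ₗ[ℝ] ℝ).isLinear s)).linear_image _

lemma aemeasurable_lexWeight {n : ℕ} (v : Fin n → E) (i : Fin n) :
    AEMeasurable (fun x => lexWeight v x i) μ := by
  refine NullMeasurable.aemeasurable (μ := μ) ?_
  have : Measurable[NullMeasurableSpace.instMeasurableSpace (α := E) (μ := μ)]
      fun x : NullMeasurableSpace E μ => lexWeight v x i :=
    measurable_of_Ioi fun s => nullMeasurableSet_lt_lexWeight μ v i s
  exact fun s hs => this hs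

lemma measure_lt_lexWeight_le {n : ℕ} (v : Fin n → E) (i : Fin n) {s : ℝ} (hs : 0 < s) :
    μ {x | s < lexWeight v x i} ≤
      ENNReal.ofReal (Real.exp (-(Module.finrank ℝ E * s))) * μ {x | 0 < lexWeight v x i} := by
  rcases le_or_gt 1 s with h1 | h1
  · have : {x | s < lexWeight v x i} = ∅ := by
      rw [setOf_lt_lexWeight v i hs.le, Set.image_eq_empty, Set.eq_empty_iff_forall_notMem]
      rintro a ⟨ha, has⟩
      exact ((mem_Icc_of_mem_stdSimplex ha.1 i).2.trans h1).not_gt has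
    simp [this]
  have hsub : {x | s < lexWeight v x i} ⊆
      AffineMap.homothety (v i) (1 - s) '' {x | 0 < lexWeight v x i} := by
    rw [setOf_lt_lexWeight v i hs.le, setOf_lt_lexWeight v i le_rfl]
    rintro _ ⟨a, ⟨ha, has⟩, rfl⟩
    have h1s : 0 < 1 - s := by linarith
    set b : Fin n → ℝ := (1 - s)⁻¹ • (a - s • Pi.single i 1)
    have hbi : ∀ j, j ≠ i → b j = (1 - s)⁻¹ * a j := fun j hj => by simp [b, hj]
    have hbi' : b i = (1 - s)⁻¹ * (a i - s) := by simp [b]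
    have hpos : 0 < b i := by
      rw [hbi']
      exact mul_pos (inv_pos.2 h1s) (sub_pos.2 has)
    have hb : b ∈ lexMinWeights v := by
      refine mem_lexMinWeights_of_support ha ⟨fun j => ?_, ?_⟩ fun j hj => ?_
      · by_cases hj : j = i
        · exact hj ▸ hpos.le
        · rw [hbi j hj]
          exact mul_nonneg (inv_pos.2 h1s).le (ha.1.1 j)
      · simp [b, ← Finset.mul_sum, ha.1.2, h1s.ne']
      · rw [hbi j (by rintro rfl; linarith), hj, mul_zero]
    refine ⟨_, ⟨b, ⟨hb, hpos⟩, rfl⟩, ?_⟩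
    simp [b, AffineMap.homothety_apply, smul_sub, smul_smul, h1s.ne']
    module
  refine (measure_mono hsub).trans ?_
  rw [Measure.addHaar_image_homothety]
  gcongr
  rw [abs_of_nonneg (by apply pow_nonneg; linarith)]
  have := Real.add_one_le_exp (-s)
  calc (1 - s) ^ Module.finrank ℝ E ≤ Real.exp (-s) ^ Module.finrank ℝ E := by
        gcongr
        linarith
    _ = _ := by rw [← Real.exp_nat_mul]; ring_nf

lemma lintegral_sq_lexWeight_le {n : ℕ} (v : Fin n → E) (i : Fin n)
    (hd : 0 < Module.finrank ℝ E) :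
    ∫⁻ x, ENNReal.ofReal (lexWeight v x i ^ 2) ∂μ ≤
      ENNReal.ofReal (2 / Module.finrank ℝ E ^ 2) * μ {x | 0 < lexWeight v x i} := by
  have hd' : (0 : ℝ) < Module.finrank ℝ E := by exact_mod_cast hd
  have h := lintegral_rpow_eq_lintegral_meas_lt_mul μ
    (Filter.Eventually.of_forall fun x => lexWeight_nonneg v x i) (aemeasurable_lexWeight μ v i)
    (p := 2) two_pos
  simp only [Real.rpow_two] at h
  rw [h]
  have hint := Real.integral_rpow_mul_exp_neg_mul_Ioi (a := 2) two_pos hd'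
  have hle : ∫⁻ t in Set.Ioi (0 : ℝ),
        μ {x | t < lexWeight v x i} * ENNReal.ofReal (t ^ ((2 : ℝ) - 1))
      ≤ ∫⁻ t in Set.Ioi (0 : ℝ), ENNReal.ofReal
        (t ^ ((2 : ℝ) - 1) * Real.exp (-(Module.finrank ℝ E * t))) * μ {x | 0 < lexWeight v x i} := by
    refine setLIntegral_mono' measurableSet_Ioi fun t ht => ?_
    rw [ENNReal.ofReal_mul (Real.rpow_nonneg (le_of_lt ht) _), mul_assoc, mul_comm]
    gcongr
    exact measure_lt_lexWeight_le μ v i ht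
  have hint' : IntegrableOn
      (fun t : ℝ => t ^ ((2 : ℝ) - 1) * Real.exp (-(Module.finrank ℝ E * t))) (Set.Ioi 0) := by
    by_contra hn
    rw [integral_undef hn] at hint
    have : 0 < (1 / (Module.finrank ℝ E : ℝ)) ^ (2 : ℝ) * Real.Gamma 2 :=
      mul_pos (by positivity) (Real.Gamma_pos_of_pos two_pos)
    exact this.ne hint
  rw [lintegral_mul_const _ (by fun_prop), ← ofReal_integral_eq_lintegral_ofReal hint' (by
    filter_upwards [ae_restrict_mem measurableSet_Ioi] with t ht
    exact mul_nonneg (Real.rpow_nonneg (le_of_lt ht) _) (Real.exp_pos _).le), hint] at hle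
  refine (mul_le_mul_right hle _).trans_eq ?_
  rw [← mul_assoc, ← ENNReal.ofReal_mul two_pos.le]
  congr 2
  rw [Real.Gamma_two, Real.rpow_two]
  ring

lemma sum_measure_pos_lexWeight_le {n : ℕ} (v : Fin n → E) :
    ∑ i, μ {x | 0 < lexWeight v x i} ≤
      (Module.finrank ℝ E + 1 : ℕ) * μ (convexHull ℝ (Set.range v)) := by
  have h1 : ∀ i, μ {x | 0 < lexWeight v x i} =
      ∫⁻ x, Set.indicator {x | 0 < lexWeight v x i} (fun _ => 1) x ∂μ := fun i =>
    (lintegral_indicator_one₀ (nullMeasurableSet_lt_lexWeight μ v i 0)).symm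
  simp_rw [h1]
  rw [← lintegral_finsetSum' _ fun i _ =>
    (aemeasurable_const.indicator₀ (nullMeasurableSet_lt_lexWeight μ v i 0))]
  have hK : NullMeasurableSet (convexHull ℝ (Set.range v)) μ :=
    (convex_convexHull ℝ _).nullMeasurableSet μ
  calc _ ≤ ∫⁻ x, Set.indicator (convexHull ℝ (Set.range v))
        (fun _ => ((Module.finrank ℝ E + 1 : ℕ) : ENNReal)) x ∂μ := by
        refine lintegral_mono fun x => ?_
        by_cases hx : x ∈ convexHull ℝ (Set.range v)
        · rw [Set.indicator_of_mem hx]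
          rw [← image_lexMinWeights] at hx
          obtain ⟨a, ha, rfl⟩ := hx
          simp only [Set.indicator_apply, Set.mem_ofPred_eq, lexWeight_linearCombination ha,
            Finset.sum_boole]
          refine Nat.cast_le.2 (le_trans (Finset.card_le_card fun i hi => ?_)
            (card_support_le_of_mem_lexMinWeights ha))
          simpa using (Finset.mem_filter.1 hi).2.ne'
        · simp [lexWeight_of_notMem hx]
    _ = _ := by rw [lintegral_indicator_const₀ hK]

end Moment

section Frame

variable {E : Type*} [NormedAddCommGroup E] [InnerProductSpace ℝ E]

lemma norm_sq_linearCombination_le {n : ℕ} {v : Fin n → E} {ρ : ℝ}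
    (hρ : 0 ≤ ρ) (hv : ∀ y, ∑ i, inner ℝ (v i) y ^ 2 = ρ * ‖y‖ ^ 2) (a : Fin n → ℝ) :
    ‖Fintype.linearCombination ℝ v a‖ ^ 2 ≤ ρ * ∑ i, a i ^ 2 := by
  set x := Fintype.linearCombination ℝ v a with hx
  have h1 : ‖x‖ ^ 2 = ∑ i, a i * inner ℝ (v i) x := by
    rw [← real_inner_self_eq_norm_sq]
    nth_rw 1 [hx]
    simp [Fintype.linearCombination_apply, sum_inner, real_inner_smul_left]
  have h2 := Finset.sum_mul_sq_le_sq_mul_sq Finset.univ a fun i => inner ℝ (v i) x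
  rw [← h1, hv] at h2
  rcases eq_or_ne x 0 with h0 | h0
  · simpa [h0] using mul_nonneg hρ (Finset.sum_nonneg fun i _ => sq_nonneg (a i))
  · have : 0 < ‖x‖ ^ 2 := by have := norm_pos_iff.2 h0; positivity
    nlinarith

variable [FiniteDimensional ℝ E] [MeasurableSpace E] [BorelSpace E] (μ : Measure E)
  [μ.IsAddHaarMeasure]

lemma lintegral_norm_sq_convexHull_le {n : ℕ} {v : Fin n → E} {ρ : ℝ} (hρ : 0 ≤ ρ)
    (hv : ∀ y, ∑ i, inner ℝ (v i) y ^ 2 = ρ * ‖y‖ ^ 2) (hd : 0 < Module.finrank ℝ E) :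
    ∫⁻ x in convexHull ℝ (Set.range v), ENNReal.ofReal (‖x‖ ^ 2) ∂μ ≤
      ENNReal.ofReal (4 * ρ / Module.finrank ℝ E) * μ (convexHull ℝ (Set.range v)) := by
  have hd' : (1 : ℝ) ≤ Module.finrank ℝ E := by exact_mod_cast hd
  have hK : NullMeasurableSet (convexHull ℝ (Set.range v)) μ :=
    (convex_convexHull ℝ _).nullMeasurableSet μ
  calc ∫⁻ x in convexHull ℝ (Set.range v), ENNReal.ofReal (‖x‖ ^ 2) ∂μ
      ≤ ∫⁻ x in convexHull ℝ (Set.range v),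
          ENNReal.ofReal ρ * ∑ i, ENNReal.ofReal (lexWeight v x i ^ 2) ∂μ := by
        refine lintegral_mono_ae ((ae_restrict_iff'₀ hK).2 (Filter.Eventually.of_forall ?_))
        intro x hx
        rw [← image_lexMinWeights] at hx
        obtain ⟨a, ha, rfl⟩ := hx
        rw [lexWeight_linearCombination ha, ← ENNReal.ofReal_sum_of_nonneg fun i _ => sq_nonneg _,
          ← ENNReal.ofReal_mul hρ]
        exact ENNReal.ofReal_le_ofReal (norm_sq_linearCombination_le hρ hv a)
    _ ≤ ∫⁻ x, ENNReal.ofReal ρ * ∑ i, ENNReal.ofReal (lexWeight v x i ^ 2) ∂μ :=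
        setLIntegral_le_lintegral _ _
    _ = ENNReal.ofReal ρ * ∑ i, ∫⁻ x, ENNReal.ofReal (lexWeight v x i ^ 2) ∂μ := by
        rw [lintegral_const_mul' _ _ ENNReal.ofReal_ne_top, lintegral_finsetSum']
        exact fun i _ => ((aemeasurable_lexWeight μ v i).pow_const 2).ennreal_ofReal
    _ ≤ ENNReal.ofReal ρ * ∑ i, ENNReal.ofReal (2 / Module.finrank ℝ E ^ 2) *
          μ {x | 0 < lexWeight v x i} := by
        gcongr with i
        exact lintegral_sq_lexWeight_le μ v i hd
    _ ≤ ENNReal.ofReal ρ * (ENNReal.ofReal (2 / Module.finrank ℝ E ^ 2) *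
          ((Module.finrank ℝ E + 1 : ℕ) * μ (convexHull ℝ (Set.range v)))) := by
        rw [← Finset.mul_sum]
        gcongr
        exact sum_measure_pos_lexWeight_le μ v
    _ ≤ _ := by
        rw [← mul_assoc, ← mul_assoc, ← ENNReal.ofReal_natCast, ← ENNReal.ofReal_mul hρ,
          ← ENNReal.ofReal_mul (by positivity)]
        gcongr
        push_cast
        rw [le_div_iff₀ (by positivity)]
        field_simp
        nlinarith

end Frame

section Volume

open Matrix in
lemma Matrix.sum_sq_det_submatrix {m n : Type*} [Fintype m] [DecidableEq m] [Fintype n]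
    {R : Type*} [CommRing R] (W : Matrix m n R) :
    ∑ f : m → n, (W.submatrix id f).det ^ 2 = (Fintype.card m).factorial * (W * Wᵀ).det := by
  classical
  have hdet : (W * Wᵀ).det = ∑ p : m → n, (W.submatrix id p).det * ∏ i, W i (p i) := by
    simp only [det_apply', mul_apply, Finset.prod_univ_sum, Finset.mul_sum, Finset.sum_mul,
      Fintype.piFinset_univ, transpose_apply, submatrix_apply, id]
    rw [Finset.sum_comm]
    refine Finset.sum_congr rfl fun p _ => Finset.sum_congr rfl fun σ _ => ?_
    rw [Finset.prod_mul_distrib, mul_assoc]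
  calc ∑ f : m → n, (W.submatrix id f).det ^ 2
      = ∑ f : m → n, ∑ σ : Equiv.Perm m, (W.submatrix id f).det *
          ((Equiv.Perm.sign σ : ℤ) * ∏ i, W (σ i) (f i)) := by
        refine Finset.sum_congr rfl fun f _ => ?_
        rw [sq, ← Finset.mul_sum]
        congr 1
        simp [det_apply']
    _ = ∑ σ : Equiv.Perm m, ∑ f : m → n, (W.submatrix id f).det * ∏ i, W i (f i) := by
        rw [Finset.sum_comm]
        refine Finset.sum_congr rfl fun σ _ => ?_
        refine Fintype.sum_equiv (σ.arrowCongr (Equiv.refl n)) _ _ fun f => ?_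
        have h1 : W.submatrix id f = (W.submatrix id (f ∘ σ.symm)).submatrix id σ := by
          ext; simp
        have h2 : ∏ i, W (σ i) (f i) = ∏ i, W i (f (σ.symm i)) :=
          Fintype.prod_equiv σ _ _ fun i => by simp
        have h3 : ((Equiv.Perm.sign σ : ℤ) : R) * ((Equiv.Perm.sign σ : ℤ) : R) = 1 := by
          rw [← Int.cast_mul, ← Units.val_mul, Int.units_mul_self]
          simp
        have h4 : (Equiv.arrowCongr σ (Equiv.refl n)) f = f ∘ σ.symm := rfl
        rw [h4, h1, det_permute', h2]
        simp only [Function.comp_apply]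
        linear_combination ((W.submatrix id (f ∘ σ.symm)).det * ∏ i, W i (f (σ.symm i))) * h3
    _ = _ := by
        rw [hdet, Finset.sum_const, Finset.card_univ, Fintype.card_perm, nsmul_eq_mul]

open Matrix in
lemma Matrix.exists_le_sq_det_submatrix {d n : ℕ} {W : Matrix (Fin d) (Fin n) ℝ} {ρ : ℝ}
    (hn : 0 < n) (hW : W * Wᵀ = ρ • 1) :
    ∃ f : Fin d → Fin n, d.factorial * (ρ / n) ^ d ≤ (W.submatrix id f).det ^ 2 := by
  have : Nonempty (Fin n) := ⟨⟨0, hn⟩⟩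
  have hn' : (0 : ℝ) < n := by exact_mod_cast hn
  have h := W.sum_sq_det_submatrix
  rw [hW, det_smul, det_one, mul_one] at h
  obtain ⟨f, -, hf⟩ := Finset.exists_le_of_sum_le (s := (Finset.univ : Finset (Fin d → Fin n)))
    (f := fun _ => d.factorial * (ρ / n) ^ d) (g := fun f => (W.submatrix id f).det ^ 2)
    Finset.univ_nonempty (by
      rw [h, Finset.sum_const, Finset.card_univ, nsmul_eq_mul]
      simp [div_pow]
      field_simp
      rfl)
  exact ⟨f, hf⟩

open Matrix in
lemma volume_parallelepiped_cube (d : ℕ) (A : Matrix (Fin d) (Fin d) ℝ) :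
    volume (A.toEuclideanLin '' (WithLp.ofLp ⁻¹' Set.Icc (0 : Fin d → ℝ) fun _ => 1 / d)) =
      ENNReal.ofReal (|A.det| * (1 / d) ^ d) := by
  rw [Measure.addHaar_image_linearMap, LinearMap.det_toLpLin,
    (PiLp.volume_preserving_ofLp (Fin d)).measure_preimage measurableSet_Icc.nullMeasurableSet,
    Real.volume_Icc_pi, ENNReal.ofReal_mul (abs_nonneg _)]
  congr 1
  rw [← ENNReal.ofReal_prod_of_nonneg (by intros; simp)]
  simp

open Matrix in
lemma image_cube_subset_convexHull {d n : ℕ} {v : Fin n → EuclideanSpace ℝ (Fin d)}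
    (h0 : 0 ∈ convexHull ℝ (Set.range v)) (f : Fin d → Fin n) :
    ((Matrix.of fun a i => v i a).submatrix id f).toEuclideanLin ''
      (WithLp.ofLp ⁻¹' Set.Icc (0 : Fin d → ℝ) fun _ => 1 / d) ⊆ convexHull ℝ (Set.range v) := by
  rintro _ ⟨x, ⟨hx0, hx1⟩, rfl⟩
  have hx : ((Matrix.of fun a i => v i a).submatrix id f).toEuclideanLin x =
      ∑ k, x k • v (f k) + (1 - ∑ k, x k) • 0 := by
    ext a
    simp [mulVec, dotProduct, mul_comm]
  have hsum : ∑ k, x k ≤ 1 := by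
    calc ∑ k, x k ≤ ∑ _k : Fin d, (1 / d : ℝ) := Finset.sum_le_sum fun k _ => hx1 k
      _ ≤ 1 := by
        rw [Finset.sum_const, Finset.card_univ, Fintype.card_fin, nsmul_eq_mul]
        rw [mul_one_div]
        exact div_self_le_one _
  rw [hx]
  have hmem := (convex_convexHull ℝ (Set.range v)).sum_mem
    (t := (Finset.univ : Finset (Option (Fin d))))
    (w := fun o => o.elim (1 - ∑ k, x k) fun k => x k) (z := fun o => o.elim 0 fun k => v (f k))
    (fun o _ => ?_) (by simp) (fun o _ => ?_)
  · simpa [add_comm] using hmem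
  · cases o with
    | none => simpa using hsum
    | some k => exact hx0 k
  · cases o with
    | none => exact h0
    | some k => exact subset_convexHull ℝ _ ⟨f k, rfl⟩

open Matrix in
lemma le_sq_volume_convexHull {d n : ℕ} {v : Fin n → EuclideanSpace ℝ (Fin d)} {ρ : ℝ}
    (hn : 0 < n) (hd : 0 < d) (hρ : 0 ≤ ρ) (h0 : 0 ∈ convexHull ℝ (Set.range v))
    (hv : (Matrix.of fun a i => v i a) * (Matrix.of fun a i => v i a)ᵀ = ρ • 1) :
    (ρ / (Real.exp 1 * n * d)) ^ d ≤ (volume (convexHull ℝ (Set.range v))).toReal ^ 2 := by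
  have hn' : (0 : ℝ) < n := by exact_mod_cast hn
  have hd' : (0 : ℝ) < d := by exact_mod_cast hd
  obtain ⟨f, hf⟩ := Matrix.exists_le_sq_det_submatrix hn hv
  set A := (Matrix.of fun a i => v i a).submatrix id f
  have hfin : volume (convexHull ℝ (Set.range v)) ≠ ⊤ :=
    ((isBounded_convexHull.2 (Set.finite_range v).isBounded).measure_lt_top).ne
  have hle := ENNReal.toReal_mono hfin (measure_mono (image_cube_subset_convexHull h0 f))
  rw [volume_parallelepiped_cube, ENNReal.toReal_ofReal (by positivity)] at hle
  refine le_trans ?_ (pow_le_pow_left₀ (by positivity) hle 2)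
  rw [mul_pow, sq_abs]
  refine le_trans ?_ (mul_le_mul_of_nonneg_right hf (by positivity))
  have hexp : (d : ℝ) ^ d / d.factorial ≤ Real.exp 1 ^ d := by
    rw [← Real.exp_nat_mul, mul_one]
    exact Real.pow_div_factorial_le_exp _ hd'.le d
  rw [div_le_iff₀ (by positivity)] at hexp
  calc (ρ / (Real.exp 1 * n * d)) ^ d
      = (ρ / n) ^ d * (d ^ d / Real.exp 1 ^ d) * ((1 / d) ^ d) ^ 2 := by
        simp only [div_pow, mul_pow, one_pow]
        field_simp
    _ ≤ (ρ / n) ^ d * d.factorial * ((1 / d) ^ d) ^ 2 := by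
        gcongr
        rw [div_le_iff₀ (by positivity)]
        linarith
    _ = _ := by ring

end Volume

section Position

variable {d n : ℕ}

lemma inner_eq_transpose_mulVec (v : Fin n → EuclideanSpace ℝ (Fin d))
    (y : EuclideanSpace ℝ (Fin d)) (i : Fin n) :
    inner ℝ (v i) y = ((Matrix.of fun a i => v i a).transpose.mulVec y.ofLp) i := by
  simp [PiLp.inner_apply, Matrix.mulVec, dotProduct, mul_comm]

open Matrix in
lemma sum_inner_sq_eq_of_mul_transpose {v : Fin n → EuclideanSpace ℝ (Fin d)} {ρ : ℝ}
    (hv : (Matrix.of fun a i => v i a) * (Matrix.of fun a i => v i a)ᵀ = ρ • 1)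
    (y : EuclideanSpace ℝ (Fin d)) : ∑ i, inner ℝ (v i) y ^ 2 = ρ * ‖y‖ ^ 2 := by
  have h : ∑ i, inner ℝ (v i) y ^ 2 =
      ((Matrix.of fun a i => v i a)ᵀ *ᵥ y.ofLp) ⬝ᵥ ((Matrix.of fun a i => v i a)ᵀ *ᵥ y.ofLp) := by
    simp only [inner_eq_transpose_mulVec, dotProduct, sq]
  rw [h, dotProduct_mulVec, vecMul_transpose, mulVec_mulVec, hv, smul_mulVec, one_mulVec,
    smul_dotProduct, smul_eq_mul, EuclideanSpace.real_norm_sq_eq]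
  simp [dotProduct, sq]

lemma eq_zero_of_forall_inner_sub_eq_zero {E : Type*} [NormedAddCommGroup E]
    [InnerProductSpace ℝ E] {ι : Type*} {v : ι → E}
    (hK : (interior (convexHull ℝ (Set.range v))).Nonempty) (c : E) {y : E}
    (hy : ∀ i, inner ℝ (v i - c) y = 0) : y = 0 := by
  have hsub : convexHull ℝ (Set.range v) ⊆ {x | inner ℝ x y = inner ℝ c y} := by
    refine convexHull_min ?_ (convex_hyperplane ⟨fun a b => inner_add_left a b y,
      fun a b => by simp [inner_smul_left]⟩ _)
    rintro _ ⟨i, rfl⟩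
    simpa [inner_sub_left, sub_eq_zero] using hy i
  obtain ⟨x, hx⟩ := hK
  have hev : ∀ᶠ t : ℝ in nhds 0, x + t • y ∈ interior (convexHull ℝ (Set.range v)) := by
    have hc : Continuous fun t : ℝ => x + t • y := by fun_prop
    exact hc.continuousAt.eventually_mem (isOpen_interior.mem_nhds (by simpa using hx))
  obtain ⟨t, ht, ht0⟩ := ((hev.filter_mono nhdsWithin_le_nhds).and
    (self_mem_nhdsWithin : Set.Ioi (0 : ℝ) ∈ nhdsWithin 0 (Set.Ioi 0))).exists
  have h1 := hsub (interior_subset ht)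
  have h2 := hsub (interior_subset hx)
  simp only [Set.mem_ofPred_eq, inner_add_left, inner_smul_left, conj_trivial] at h1 h2
  have h3 : t * inner ℝ y y = 0 := by linarith
  exact inner_self_eq_zero.1 ((mul_eq_zero.1 h3).resolve_left (ne_of_gt ht0))

open Matrix in
lemma posDef_mul_transpose_of_interior_nonempty {v : Fin n → EuclideanSpace ℝ (Fin d)}
    (hK : (interior (convexHull ℝ (Set.range v))).Nonempty) (c : EuclideanSpace ℝ (Fin d)) :
    ((Matrix.of fun a i => (v i - c) a) * (Matrix.of fun a i => (v i - c) a)ᵀ).PosDef := by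
  have h := PosDef.mul_conjTranspose_self
    (Matrix.of fun a i => (v i - c) a : Matrix (Fin d) (Fin n) ℝ) ?_
  · rwa [conjTranspose_eq_transpose_of_trivial] at h
  · refine (injective_iff_map_eq_zero (Matrix.vecMulLinear
      (Matrix.of fun a i => (v i - c) a : Matrix (Fin d) (Fin n) ℝ))).2 fun y hy => ?_
    have := eq_zero_of_forall_inner_sub_eq_zero hK c (y := WithLp.toLp 2 y) fun i => by
      rw [inner_eq_transpose_mulVec (fun i => v i - c), mulVec_transpose]
      exact congrFun hy i
    exact congrArg WithLp.ofLp this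

open Matrix in
open scoped MatrixOrder in
lemma Matrix.PosDef.exists_det_eq_one_mul_mul_transpose (hd : 0 < d)
    {M : Matrix (Fin d) (Fin d) ℝ} (hM : M.PosDef) :
    ∃ (B : Matrix (Fin d) (Fin d) ℝ) (ρ : ℝ), B.det = 1 ∧ 0 < ρ ∧ B * M * Bᵀ = ρ • 1 := by
  have hQ : (CFC.sqrt M).PosDef := hM.isStrictlyPositive.sqrt.posDef
  have hQQ : CFC.sqrt M * CFC.sqrt M = M := CFC.sqrt_mul_sqrt_self M hM.posSemidef.nonneg
  generalize CFC.sqrt M = Q at hQ hQQ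
  have hdet : 0 < Q.det := hQ.det_pos
  have hu : IsUnit Q.det := hdet.ne'.isUnit
  have hQT : Qᵀ = Q := by
    rw [← conjTranspose_eq_transpose_of_trivial]; exact hQ.isHermitian
  set s : ℝ := Q.det ^ ((d : ℝ)⁻¹) with hs
  have hs0 : 0 < s := Real.rpow_pos_of_pos hdet _
  refine ⟨s • Q⁻¹, s ^ 2, ?_, by positivity, ?_⟩
  · rw [det_smul, Fintype.card_fin, hs, Real.rpow_inv_natCast_pow hdet.le hd.ne', det_nonsing_inv,
      Ring.mul_inverse_cancel _ hu]
  · rw [transpose_smul, transpose_nonsing_inv, hQT, ← hQQ]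
    rw [Matrix.smul_mul, Matrix.smul_mul, Matrix.mul_smul, smul_smul, ← sq,
      ← Matrix.mul_assoc Q⁻¹ Q Q, nonsing_inv_mul _ hu, Matrix.one_mul, mul_nonsing_inv _ hu]

/-- A polytope with nonempty interior has a volume-preserving affine image containing the origin
whose vertices form a tight frame. -/
lemma exists_affine_image_convexHull_tight {v : Fin n → EuclideanSpace ℝ (Fin d)} (hd : 0 < d)
    (hK : (interior (convexHull ℝ (Set.range v))).Nonempty) :
    ∃ (a : EuclideanSpace ℝ (Fin d))
      (T : EuclideanSpace ℝ (Fin d) →ₗ[ℝ] EuclideanSpace ℝ (Fin d))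
      (w : Fin n → EuclideanSpace ℝ (Fin d)) (ρ : ℝ),
      LinearMap.det T = 1 ∧ 0 < ρ ∧
      (fun y => a + T y) '' convexHull ℝ (Set.range v) = convexHull ℝ (Set.range w) ∧
      0 ∈ convexHull ℝ (Set.range w) ∧
      (Matrix.of fun a i => w i a) * (Matrix.of fun a i => w i a).transpose = ρ • 1 := by
  obtain ⟨c, hc⟩ := hK.mono interior_subset
  obtain ⟨B, ρ, hB, hρ, hBM⟩ :=
    (posDef_mul_transpose_of_interior_nonempty hK c).exists_det_eq_one_mul_mul_transpose hd
  set T := Matrix.toLpLin 2 2 B with hT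
  have himage : (fun y => -T c + T y) '' convexHull ℝ (Set.range v) =
      convexHull ℝ (Set.range fun i => T (v i - c)) := by
    have h := (AffineMap.const ℝ _ (-T c) + T.toAffineMap).image_convexHull (Set.range v)
    rw [← Set.range_comp] at h
    refine h.trans (congrArg _ (congrArg Set.range (funext fun i => ?_)))
    simp [sub_eq_neg_add]
  refine ⟨-T c, T, fun i => T (v i - c), ρ, ?_, hρ, himage, himage ▸ ⟨c, hc, by simp⟩, ?_⟩
  · rw [hT, LinearMap.det_toLpLin, hB]
  · have hW : (Matrix.of fun a i => T (v i - c) a) = B * Matrix.of fun a i => (v i - c) a := by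
      ext a i
      simp [hT, Matrix.mul_apply, Matrix.mulVec, dotProduct, Matrix.toLpLin_apply]
    rw [hW, Matrix.transpose_mul, ← hBM]
    simp only [Matrix.mul_assoc]

lemma volume_image_add_linearMap {E : Type*} [NormedAddCommGroup E] [NormedSpace ℝ E]
    [MeasurableSpace E] [BorelSpace E] [FiniteDimensional ℝ E] (μ : Measure E)
    [μ.IsAddHaarMeasure] {T : E →ₗ[ℝ] E} (hT : LinearMap.det T = 1) (a : E) (s : Set E) :
    μ ((fun y => a + T y) '' s) = μ s := by
  have h : (fun y => a + T y) '' s = (fun y => a + y) '' (T '' s) := by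
    rw [Set.image_image]
  rw [h, Set.image_add_left, measure_preimage_add, Measure.addHaar_image_linearMap, hT]
  simp

/-- The normalized second moment of a convex hull of `n` points forming a tight frame. -/
lemma rpow_volume_mul_integral_norm_sq_le (hn : 0 < n) (hd : 0 < d)
    {w : Fin n → EuclideanSpace ℝ (Fin d)} {ρ : ℝ} (hρ : 0 < ρ)
    (h0 : 0 ∈ convexHull ℝ (Set.range w))
    (hw : (Matrix.of fun a i => w i a) * (Matrix.of fun a i => w i a).transpose = ρ • 1) :
    (volume (convexHull ℝ (Set.range w))).toReal ^ (-(1 + 2 / (d : ℝ))) *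
      ∫ x in convexHull ℝ (Set.range w), ‖x‖ ^ 2 ≤ 16 * n := by
  set K := convexHull ℝ (Set.range w)
  have hfin : volume K ≠ ⊤ :=
    ((isBounded_convexHull.2 (Set.finite_range w).isBounded).measure_lt_top).ne
  have hvol := le_sq_volume_convexHull hn hd hρ.le h0 hw
  set V := (volume K).toReal
  have hd' : (0 : ℝ) < d := by exact_mod_cast hd
  have hn' : (0 : ℝ) < n := by exact_mod_cast hn
  have hq : 0 < ρ / (Real.exp 1 * n * d) := by positivity
  have hV : 0 < V := (sq_pos_iff.1 ((pow_pos hq d).trans_le hvol)).lt_of_le' ENNReal.toReal_nonneg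
  have hmom : ∫ x in K, ‖x‖ ^ 2 ≤ 4 * ρ / d * V := by
    rw [integral_eq_lintegral_of_nonneg_ae (.of_forall fun x => sq_nonneg _) (by fun_prop)]
    have h := lintegral_norm_sq_convexHull_le (volume : Measure (EuclideanSpace ℝ (Fin d)))
      hρ.le (sum_inner_sq_eq_of_mul_transpose hw) (by simpa using hd)
    rw [finrank_euclideanSpace_fin] at h
    refine (ENNReal.toReal_mono (ENNReal.mul_ne_top ENNReal.ofReal_ne_top hfin) h).trans_eq ?_
    rw [ENNReal.toReal_mul, ENNReal.toReal_ofReal (by positivity)]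
  have hroot : ρ / (Real.exp 1 * n * d) ≤ V ^ (2 / (d : ℝ)) := by
    have h := Real.rpow_le_rpow (by positivity) hvol (inv_nonneg.2 hd'.le)
    rwa [Real.pow_rpow_inv_natCast hq.le hd.ne', ← Real.rpow_natCast V 2, ← Real.rpow_mul hV.le]
      at h
  have hVd : 0 < V ^ (2 / (d : ℝ)) := Real.rpow_pos_of_pos hV _
  calc V ^ (-(1 + 2 / (d : ℝ))) * ∫ x in K, ‖x‖ ^ 2
      ≤ V ^ (-(1 + 2 / (d : ℝ))) * (4 * ρ / d * V) := by gcongr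
    _ = 4 * ρ / d / V ^ (2 / (d : ℝ)) := by
        rw [Real.rpow_neg hV.le, Real.rpow_add hV, Real.rpow_one]
        field_simp
    _ ≤ 16 * n := by
        rw [div_le_iff₀ hVd]
        have he : Real.exp 1 ≤ 4 := Real.exp_one_lt_three.le.trans (by norm_num)
        calc 4 * ρ / d = 4 * Real.exp 1 * n * (ρ / (Real.exp 1 * n * d)) := by field_simp
          _ ≤ 4 * 4 * n * V ^ (2 / (d : ℝ)) := by gcongr
          _ = 16 * n * V ^ (2 / (d : ℝ)) := by ring

end Position

theorem isotropy_constant_of_polytope_with_n_vertices :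
    ∃ C > 0, ∀ (d n : ℕ) (v : Fin n → EuclideanSpace ℝ (Fin d))
      (K : Set (EuclideanSpace ℝ (Fin d))),
      K = convexHull ℝ (Set.range v) → (interior K).Nonempty →
      isoConst d K ≤ C * Real.sqrt (n / d) := by
  refine ⟨4, by norm_num, fun d n v K hK hint => ?_⟩
  subst hK
  unfold isoConst
  rcases Nat.eq_zero_or_pos d with rfl | hd
  · simp
  have hn : 0 < n := by
    rcases Nat.eq_zero_or_pos n with rfl | hn
    · simp at hint
    · exact hn
  obtain ⟨a, T, w, ρ, hT, hρ, himage, h0, hw⟩ := exists_affine_image_convexHull_tight hd hint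
  have hbdd : BddBelow (isoSet d (convexHull ℝ (Set.range v))) := by
    refine ⟨0, ?_⟩
    rintro _ ⟨a, T, -, rfl⟩
    exact mul_nonneg (Real.rpow_nonneg ENNReal.toReal_nonneg _)
      (integral_nonneg fun x => sq_nonneg _)
  have hle : sInf (isoSet d (convexHull ℝ (Set.range v))) ≤ 16 * n := by
    refine (csInf_le hbdd ⟨a, T, hT, rfl⟩).trans ?_
    rw [← volume_image_add_linearMap volume hT a, himage]
    exact rpow_volume_mul_integral_norm_sq_le hn hd hρ h0 hw
  calc √(sInf (isoSet d (convexHull ℝ (Set.range v))) / d)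
      ≤ √(4 ^ 2 * (n / d)) := by
        refine Real.sqrt_le_sqrt ?_
        rw [← mul_div_assoc]
        gcongr
        linarith
    _ = 4 * √(n / d) := by
        rw [Real.sqrt_mul (by positivity), Real.sqrt_sq (by norm_num)]
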